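/- For all sufficiently small ε and all sufficiently small perturbations, if k ≥ 2 is even then the halving edges graph of a parallel k-fission H of S is bipartite. -/

import Mathlib

noncomputable section

/-- The plane. -/
abbrev Pt : Type := EuclideanSpace ℝ (Fin 2)

/-- Signed determinant of the triple `(p, q, r)`: positive iff `r` lies on the left of
the directed line from `p` to `q`. -/
def det2 (p q r : Pt) : ℝ :=
  (q 0 - p 0) * (r 1 - p 1) - (q 1 - p 1) * (r 0 - p 0)

/-- A finite set of points in the plane is in general position if no three of its
(distinct) points are collinear. -/
def GenPos (S : Finset Pt) : Prop :=
  ∀ p ∈ S, ∀ q ∈ S, ∀ r ∈ S, p ≠ q → p ≠ r → q ≠ r →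
    ¬ Collinear ℝ ({p, q, r} : Set Pt)

/-- `{p, q}` is a halving edge of `S`: `p, q` are distinct points of `S` and the open
half-planes on the two sides of the line through `p` and `q` each contain exactly
`(|S| - 2)/2` points of `S`. -/
def HalvingEdge (S : Finset Pt) (p q : Pt) : Prop :=
  p ∈ S ∧ q ∈ S ∧ p ≠ q ∧
    {r ∈ (S : Set Pt) | 0 < det2 p q r}.ncard = (S.card - 2) / 2 ∧
    {r ∈ (S : Set Pt) | det2 p q r < 0}.ncard = (S.card - 2) / 2

/-- The halving edges graph of `S` (as a graph on the whole plane; all vertices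
outside `S` are isolated). -/
def halvingGraph (S : Finset Pt) : SimpleGraph Pt :=
  SimpleGraph.fromRel (HalvingEdge S)

/-- The number of halving edges of `S`. -/
def halvingEdgeCount (S : Finset Pt) : ℕ :=
  {e : Sym2 Pt | ∃ p q, e = s(p, q) ∧ HalvingEdge S p q}.ncard

/-- `H`, together with the cluster map `cl`, is a `k`-fission of `S` within `ε`:
`H` is a set of `k * |S|` points in general position partitioned into clusters
`cl v` of `k` points, one for each `v ∈ S`, with each point of the `v`-cluster
within distance `ε` of `v`. -/
structure IsFission (S : Finset Pt) (k : ℕ) (ε : ℝ) (H : Finset Pt)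
    (cl : Pt → Finset Pt) : Prop where
  genPos : GenPos H
  cluster_card : ∀ v ∈ S, (cl v).card = k
  disj : ∀ v ∈ S, ∀ w ∈ S, v ≠ w → Disjoint (cl v) (cl w)
  union_eq : (H : Set Pt) = ⋃ v ∈ S, (cl v : Set Pt)
  close : ∀ v ∈ S, ∀ x ∈ cl v, dist x v ≤ ε

/-- A fission is plain if no halving edge of `H` has both endpoints in the same cluster. -/
def IsPlain (S : Finset Pt) (H : Finset Pt) (cl : Pt → Finset Pt) : Prop :=
  ∀ v ∈ S, ∀ p ∈ cl v, ∀ q ∈ cl v, ¬ HalvingEdge H p q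


local instance : DecidableEq Pt := Classical.decEq _

/-- `H`, with cluster points `c v m` (the `m`-th point of the `v`-cluster, ordered along
the common direction `d`), is a parallel `k`-fission of `S` within `ε`, obtained by a
perturbation of size at most `δ` of the configuration in which every `v ∈ S` is replaced
by the translated copy `v + t m • d` (`m = 0, …, k-1`) of a fixed set of `k` points on a
line with direction `d`; the direction `d` is not parallel to any segment joining two
points of `S`. -/
structure IsParallelFission (S : Finset Pt) (k : ℕ) (ε δ : ℝ) (d : Pt) (t : Fin k → ℝ)
    (H : Finset Pt) (c : Pt → Fin k → Pt) : Prop where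
  d_ne : d ≠ 0
  not_parallel : ∀ v ∈ S, ∀ w ∈ S, v ≠ w → ∀ r : ℝ, w - v ≠ r • d
  t_mono : StrictMono t
  genPos : GenPos H
  card_eq : H.card = k * S.card
  union_eq : (H : Set Pt) = {x | ∃ v ∈ S, ∃ m : Fin k, x = c v m}
  perturb : ∀ v ∈ S, ∀ m : Fin k, dist (c v m) (v + t m • d) ≤ δ
  close : ∀ v ∈ S, ∀ m : Fin k, dist (c v m) v ≤ ε

open Filter Topology

/-- A vector whose cross product with `d ≠ 0` vanishes is a multiple of `d`. -/
theorem exists_eq_smul_of_cross_eq_zero {d x : Pt} (hd : d ≠ 0)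
    (h : x 0 * d 1 - x 1 * d 0 = 0) : ∃ r : ℝ, x = r • d := by
  by_cases h0 : d 0 = 0
  · have h1 : d 1 ≠ 0 := by
      intro h1
      apply hd
      ext i
      fin_cases i <;> simp [h0, h1]
    refine ⟨x 1 / d 1, ?_⟩
    ext i
    fin_cases i
    · have : x 0 = 0 := by simpa [h0, h1] using h
      simp [h0, this]
    · simp [h1]
  · refine ⟨x 0 / d 0, ?_⟩
    ext i
    fin_cases i
    · simp [h0]
    · simp only [Fin.mk_one, PiLp.smul_apply, smul_eq_mul]
      field_simp
      linarith

theorem GenPos.det2_ne_zero {S : Finset Pt} (hS : GenPos S) {p q r : Pt} (hp : p ∈ S)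
    (hq : q ∈ S) (hr : r ∈ S) (hpq : p ≠ q) (hpr : p ≠ r) (hqr : q ≠ r) :
    det2 p q r ≠ 0 := by
  intro h
  apply hS p hp q hq r hr hpq hpr hqr
  obtain ⟨s, hs⟩ := exists_eq_smul_of_cross_eq_zero (d := q - p) (x := r - p)
    (sub_ne_zero.mpr hpq.symm) (by
      simp only [det2, PiLp.sub_apply] at h ⊢
      linarith)
  rw [collinear_iff_of_mem (p₀ := p) (by simp)]
  refine ⟨q - p, fun x hx => ?_⟩
  simp only [Set.mem_insert_iff, Set.mem_singleton_iff] at hx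
  rcases hx with rfl | rfl | rfl
  · exact ⟨0, by simp⟩
  · exact ⟨1, by simp⟩
  · exact ⟨s, by rw [← hs]; simp⟩

theorem det2_sign_stable {a b c : Pt} (h : det2 a b c ≠ 0) :
    ∀ᶠ δ in 𝓝[>] (0 : ℝ), ∀ p q r : Pt, dist p a ≤ δ → dist q b ≤ δ → dist r c ≤ δ →
      (0 < det2 p q r ↔ 0 < det2 a b c) := by
  have hcont : Continuous fun x : Pt × Pt × Pt => det2 x.1 x.2.1 x.2.2 := by
    unfold det2
    fun_prop
  have hev : ∀ᶠ x : Pt × Pt × Pt in 𝓝 (a, b, c),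
      (0 < det2 x.1 x.2.1 x.2.2 ↔ 0 < det2 a b c) := by
    rcases lt_or_gt_of_ne h with h | h
    · filter_upwards [hcont.continuousAt.eventually_lt_const h] with x hx
      exact iff_of_false hx.not_gt h.not_gt
    · filter_upwards [hcont.continuousAt.eventually_const_lt h] with x hx
      exact iff_of_true hx h
  obtain ⟨η, hη, hball⟩ := Metric.eventually_nhds_iff.mp hev
  filter_upwards [Ioo_mem_nhdsGT hη] with δ hδ p q r hp hq hr
  refine hball (y := (p, q, r)) ?_
  simp only [Prod.dist_eq, max_lt_iff]
  exact ⟨hp.trans_lt hδ.2, hq.trans_lt hδ.2, hr.trans_lt hδ.2⟩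

/-- The orientations of all nondegenerate triples in a finite set of triples are stable under
small perturbations. -/
theorem exists_forall_det2_sign_stable (T : Finset (Pt × Pt × Pt)) :
    ∃ δ₀ > 0, ∀ x ∈ T, det2 x.1 x.2.1 x.2.2 ≠ 0 → ∀ p q r : Pt,
      dist p x.1 ≤ δ₀ → dist q x.2.1 ≤ δ₀ → dist r x.2.2 ≤ δ₀ →
      (0 < det2 p q r ↔ 0 < det2 x.1 x.2.1 x.2.2) := by
  have h : ∀ᶠ δ in 𝓝[>] (0 : ℝ), ∀ x ∈ T, det2 x.1 x.2.1 x.2.2 ≠ 0 → ∀ p q r : Pt,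
      dist p x.1 ≤ δ → dist q x.2.1 ≤ δ → dist r x.2.2 ≤ δ →
      (0 < det2 p q r ↔ 0 < det2 x.1 x.2.1 x.2.2) := by
    rw [Finset.eventually_all]
    intro x _
    by_cases hx : det2 x.1 x.2.1 x.2.2 = 0
    · exact Eventually.of_forall fun _ h => absurd hx h
    · filter_upwards [det2_sign_stable hx] with δ hδ _
      exact hδ
  obtain ⟨δ, hδ, hpos⟩ := (h.and self_mem_nhdsWithin).exists
  exact ⟨δ, hpos, hδ⟩

/-- The number of points of the cluster `c u` to the left of the line from `p` to `q`. -/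
def leftCount {k : ℕ} (c : Pt → Fin k → Pt) (p q u : Pt) : ℕ :=
  (Finset.univ.filter fun m : Fin k => 0 < det2 p q (c u m)).card

theorem ncard_left_eq_sum {S H : Finset Pt} {k : ℕ} {c : Pt → Fin k → Pt}
    (hcard : H.card = k * S.card)
    (hun : (H : Set Pt) = {x | ∃ v ∈ S, ∃ m : Fin k, x = c v m}) (p q : Pt) :
    {r ∈ (H : Set Pt) | 0 < det2 p q r}.ncard = ∑ u ∈ S, leftCount c p q u := by
  have hH : H = (S ×ˢ (Finset.univ : Finset (Fin k))).image fun x => c x.1 x.2 := by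
    ext x
    rw [← Finset.mem_coe, hun]
    simp only [Set.mem_ofPred_eq, Finset.mem_image, Finset.mem_product, Finset.mem_univ,
      and_true, Prod.exists]
    constructor
    · rintro ⟨v, hv, m, rfl⟩
      exact ⟨v, m, hv, rfl⟩
    · rintro ⟨v, m, hv, rfl⟩
      exact ⟨v, hv, m, rfl⟩
  have hinj : Set.InjOn (fun x : Pt × Fin k => c x.1 x.2)
      (S ×ˢ (Finset.univ : Finset (Fin k)) : Finset (Pt × Fin k)) := by
    rw [← Finset.card_image_iff, ← hH, hcard, Finset.card_product, Finset.card_univ,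
      Fintype.card_fin, mul_comm]
  have hset : {r ∈ (H : Set Pt) | 0 < det2 p q r} =
      ((H.filter fun r => 0 < det2 p q r : Finset Pt) : Set Pt) := by
    ext x
    simp
  rw [hset, Set.ncard_coe_finset, hH, Finset.filter_image, Finset.card_image_of_injOn
    (hinj.mono (by exact_mod_cast Finset.filter_subset _ _)), Finset.card_filter,
    Finset.sum_product]
  simp only [leftCount, Finset.card_filter]

/-- If no point of a cluster changes side, the cluster contributes a multiple of `k`. -/
theorem dvd_leftCount {k : ℕ} {c : Pt → Fin k → Pt} {p q u : Pt} {P : Prop}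
    (h : ∀ m, 0 < det2 p q (c u m) ↔ P) : k ∣ leftCount c p q u := by
  unfold leftCount
  by_cases hP : P <;> simp [h, hP]

theorem card_filter_mul_pos {k : ℕ} {t : Fin k → ℝ} (ht : StrictMono t) (i : Fin k) {D : ℝ}
    (hD : D ≠ 0) :
    (Finset.univ.filter fun m : Fin k => 0 < (t m - t i) * D).card =
      if 0 < D then k - 1 - (i : ℕ) else (i : ℕ) := by
  split_ifs with h
  · rw [← Fin.card_Ioi]
    congr 1
    ext m
    simp [mul_pos_iff_of_pos_right h, ht.lt_iff_lt]
  · have h' : D < 0 := lt_of_le_of_ne (not_lt.mp h) hD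
    rw [← Fin.card_Iio]
    congr 1
    ext m
    simp [mul_pos_iff, h, h', ht.lt_iff_lt]

theorem det2_same_left (p q : Pt) : det2 p q p = 0 := by simp [det2]

theorem det2_same_right (p q : Pt) : det2 p q q = 0 := by
  simp only [det2]
  ring

theorem exists_halving_add_one_eq_mul {S H : Finset Pt} {k : ℕ} (hcard : Even S.card) (hk : 2 ≤ k)
    (hH : H.card = k * S.card) (hne : S.Nonempty) :
    ∃ n, (H.card - 2) / 2 + 1 = k * n := by
  obtain ⟨n, hn⟩ := hcard
  have hpos := hne.card_pos
  have hn1 : 1 ≤ n := by omega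
  refine ⟨n, ?_⟩
  have h1 : 2 ≤ k * n := le_trans hk (Nat.le_mul_of_pos_right k hn1)
  have h2 : H.card = 2 * (k * n) := by rw [hH, hn]; ring
  omega

/-- In a parallel fission with an even number of points per cluster, the indices of the
endpoints of a halving edge have different parities. -/
theorem odd_index_add_of_halvingEdge {S H : Finset Pt} {k : ℕ} {d : Pt} {t : Fin k → ℝ}
    {c : Pt → Fin k → Pt} (hcard : Even S.card) (hk : 2 ≤ k) (hkeven : Even k)
    (ht : StrictMono t) (hHcard : H.card = k * S.card)
    (hun : (H : Set Pt) = {x | ∃ v ∈ S, ∃ m : Fin k, x = c v m})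
    (hD : ∀ v ∈ S, ∀ w ∈ S, v ≠ w → det2 0 (w - v) d ≠ 0)
    (hthree : ∀ v ∈ S, ∀ w ∈ S, ∀ u ∈ S, v ≠ w → u ≠ v → u ≠ w → ∀ i j m,
      (0 < det2 (c v i) (c w j) (c u m) ↔ 0 < det2 v w u))
    (htwo : ∀ v ∈ S, ∀ w ∈ S, ∀ u ∈ S, ∀ i j m,
      det2 (v + t i • d) (w + t j • d) (u + t m • d) ≠ 0 →
      (0 < det2 (c v i) (c w j) (c u m) ↔
        0 < det2 (v + t i • d) (w + t j • d) (u + t m • d)))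
    {v w : Pt} (hv : v ∈ S) (hw : w ∈ S) {i j : Fin k}
    (he : HalvingEdge H (c v i) (c w j)) : Odd ((i : ℕ) + j) := by
  obtain ⟨-, -, hne, hleft, -⟩ := he
  rw [ncard_left_eq_sum hHcard hun] at hleft
  obtain ⟨n, hn⟩ := exists_halving_add_one_eq_mul hcard hk hHcard ⟨v, hv⟩
  rw [← hleft] at hn
  by_cases hvw : v = w
  · exfalso
    subst hvw
    have hij : i ≠ j := fun h => hne (by rw [h])
    have hrest : k ∣ ∑ u ∈ S.erase v, leftCount c (c v i) (c v j) u := by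
      refine Finset.dvd_sum fun u hu => ?_
      obtain ⟨huv, hu⟩ := Finset.mem_erase.mp hu
      refine dvd_leftCount (P := 0 < (t j - t i) * -det2 0 (u - v) d) fun m => ?_
      have hdet : det2 (v + t i • d) (v + t j • d) (u + t m • d) =
          (t j - t i) * -det2 0 (u - v) d := by
        simp [det2]
        ring
      rw [← hdet]
      refine htwo v hv v hv u hu i j m ?_
      rw [hdet]
      exact mul_ne_zero (sub_ne_zero.mpr (ht.injective.ne hij.symm))
        (neg_ne_zero.mpr (hD v hv u hu huv.symm))
    rw [← Finset.add_sum_erase S _ hv] at hn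
    have hlt : leftCount c (c v i) (c v j) v + 2 ≤ k := by
      have hsub : (Finset.univ.filter fun m : Fin k => 0 < det2 (c v i) (c v j) (c v m)) ⊆
          (Finset.univ.erase i).erase j := by
        intro m hm
        have hm' := (Finset.mem_filter.mp hm).2
        simp only [Finset.mem_erase, Finset.mem_univ, and_true]
        constructor
        · rintro rfl
          rw [det2_same_right] at hm'
          exact hm'.false
        · rintro rfl
          rw [det2_same_left] at hm'
          exact hm'.false
      have hc := Finset.card_le_card hsub
      rw [Finset.card_erase_of_mem (by simp [hij.symm]),
        Finset.card_erase_of_mem (Finset.mem_univ _), Finset.card_univ, Fintype.card_fin] at hc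
      unfold leftCount
      omega
    have hdvd : k ∣ leftCount c (c v i) (c v j) v + 1 := by
      rw [← Nat.dvd_add_left hrest]
      exact ⟨n, by rw [← hn]; ring⟩
    have := Nat.le_of_dvd (Nat.succ_pos _) hdvd
    omega
  · have hDvw := hD v hv w hw hvw
    have hrest : k ∣ ∑ u ∈ (S.erase v).erase w, leftCount c (c v i) (c w j) u := by
      refine Finset.dvd_sum fun u hu => ?_
      obtain ⟨huw, hu⟩ := Finset.mem_erase.mp hu
      obtain ⟨huv, hu⟩ := Finset.mem_erase.mp hu
      exact dvd_leftCount (hthree v hv w hw u hu hvw huv huw i j)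
    have hfv : leftCount c (c v i) (c w j) v =
        if 0 < det2 0 (w - v) d then k - 1 - (i : ℕ) else (i : ℕ) := by
      rw [← card_filter_mul_pos ht i hDvw]
      unfold leftCount
      congr 1
      refine Finset.filter_congr fun m _ => ?_
      by_cases hm : m = i
      · subst hm
        simp [det2_same_left]
      · have hdet : det2 (v + t i • d) (w + t j • d) (v + t m • d) =
            (t m - t i) * det2 0 (w - v) d := by
          simp [det2]
          ring
        rw [← hdet]
        refine htwo v hv w hw v hv i j m ?_
        rw [hdet]
        exact mul_ne_zero (sub_ne_zero.mpr (ht.injective.ne hm)) hDvw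
    have hfw : leftCount c (c v i) (c w j) w =
        if 0 < det2 0 (w - v) d then k - 1 - (j : ℕ) else (j : ℕ) := by
      rw [← card_filter_mul_pos ht j hDvw]
      unfold leftCount
      congr 1
      refine Finset.filter_congr fun m _ => ?_
      by_cases hm : m = j
      · subst hm
        simp [det2_same_right]
      · have hdet : det2 (v + t i • d) (w + t j • d) (w + t m • d) =
            (t m - t j) * det2 0 (w - v) d := by
          simp [det2]
          ring
        rw [← hdet]
        refine htwo v hv w hw w hw i j m ?_
        rw [hdet]
        exact mul_ne_zero (sub_ne_zero.mpr (ht.injective.ne hm)) hDvw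
    rw [← Finset.add_sum_erase S _ hv,
      ← Finset.add_sum_erase (S.erase v) _ (Finset.mem_erase.mpr ⟨Ne.symm hvw, hw⟩),
      hfv, hfw] at hn
    obtain ⟨a, ha⟩ := hkeven.two_dvd.trans hrest
    obtain ⟨b, hb⟩ : 2 ∣ k * n := hkeven.two_dvd.mul_right n
    have hi := i.isLt
    have hj := j.isLt
    rw [Nat.odd_iff]
    split_ifs at hn <;> omega

theorem stmt17 (S : Finset Pt) (hS : GenPos S) (hcard : Even S.card)
    (k : ℕ) (hk : 2 ≤ k) (hkeven : Even k) (d : Pt) (hd : d ≠ 0)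
    (hpar : ∀ v ∈ S, ∀ w ∈ S, v ≠ w → ∀ r : ℝ, w - v ≠ r • d) :
    ∃ ε₀ > 0, ∀ ε : ℝ, 0 < ε → ε ≤ ε₀ →
      ∀ t : Fin k → ℝ, StrictMono t →
        ∃ δ₀ > 0, ∀ δ : ℝ, 0 < δ → δ ≤ δ₀ →
          ∀ (H : Finset Pt) (c : Pt → Fin k → Pt),
            IsParallelFission S k ε δ d t H c →
              (halvingGraph H).Colorable 2 := by
  obtain ⟨ε₀, hε₀, hthree⟩ := exists_forall_det2_sign_stable (S ×ˢ S ×ˢ S)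
  refine ⟨ε₀, hε₀, fun ε _ hε t ht => ?_⟩
  obtain ⟨δ₀, hδ₀, htwo⟩ := exists_forall_det2_sign_stable
    (let T := (S ×ˢ (Finset.univ : Finset (Fin k))).image fun x => x.1 + t x.2 • d
    T ×ˢ T ×ˢ T)
  refine ⟨δ₀, hδ₀, fun δ _ hδ H c hH => ?_⟩
  have hD : ∀ v ∈ S, ∀ w ∈ S, v ≠ w → det2 0 (w - v) d ≠ 0 := by
    intro v hv w hw hvw h0
    obtain ⟨r, hr⟩ := exists_eq_smul_of_cross_eq_zero (x := w - v) hd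
      (by simpa [det2] using h0)
    exact hpar v hv w hw hvw r hr
  have hodd : ∀ v ∈ S, ∀ w ∈ S, ∀ i j, HalvingEdge H (c v i) (c w j) →
      Odd ((i : ℕ) + j) := by
    intro v hv w hw i j he
    refine odd_index_add_of_halvingEdge hcard hk hkeven ht hH.card_eq hH.union_eq hD
      ?_ ?_ hv hw he
    · intro v hv w hw u hu hvw huv huw i j m
      exact hthree (v, w, u) (by simp [hv, hw, hu])
        (hS.det2_ne_zero hv hw hu hvw huv.symm huw.symm) _ _ _
        ((hH.close v hv i).trans hε) ((hH.close w hw j).trans hε) ((hH.close u hu m).trans hε)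
    · intro v hv w hw u hu i j m hne
      refine htwo (v + t i • d, w + t j • d, u + t m • d) ?_ hne _ _ _
        ((hH.perturb v hv i).trans hδ) ((hH.perturb w hw j).trans hδ)
        ((hH.perturb u hu m).trans hδ)
      simp only [Finset.mem_product, Finset.mem_image, Finset.mem_univ, and_true]
      exact ⟨⟨(v, i), hv, rfl⟩, ⟨(w, j), hw, rfl⟩, ⟨(u, m), hu, rfl⟩⟩
  have hidx : ∀ x, ∃ n : ℕ, x ∈ H → ∃ v ∈ S, ∃ m : Fin k, (m : ℕ) = n ∧ x = c v m := by
    intro x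
    by_cases hx : x ∈ H
    · rw [← Finset.mem_coe, hH.union_eq] at hx
      obtain ⟨v, hv, m, rfl⟩ := hx
      exact ⟨m, fun _ => ⟨v, hv, m, rfl, rfl⟩⟩
    · exact ⟨0, fun h => absurd h hx⟩
  choose f hf using hidx
  have hcolor : ∀ x y, HalvingEdge H x y → Odd (f x + f y) := by
    intro x y he
    obtain ⟨v, hv, i, hi, hxv⟩ := hf x he.1
    obtain ⟨w, hw, j, hj, hyw⟩ := hf y he.2.1
    rw [← hi, ← hj]
    rw [hxv, hyw] at he
    exact hodd v hv w hw i j he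
  refine ⟨SimpleGraph.Coloring.mk
    (fun x => (⟨f x % 2, Nat.mod_lt _ two_pos⟩ : Fin 2)) ?_⟩
  intro x y hxy heq
  have hmod : f x % 2 = f y % 2 := congrArg Fin.val heq
  rw [halvingGraph, SimpleGraph.fromRel_adj] at hxy
  rcases hxy.2 with h | h
  · have := Nat.odd_iff.mp (hcolor x y h)
    omega
  · have := Nat.odd_iff.mp (hcolor y x h)
    omega

end
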